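/- arXiv:2602.00079 — 3 statements merged into one kernel-verified Lean document; each statement's English description precedes it below -/
import Mathlib

section
/- Let n be an integer with n ≥ 63, and let γ be the Gaussian probability measure on ℝ with mean π/2 and variance 1/n. Then γ([1, 2)) > 0.999. -/
open Real MeasureTheory ProbabilityTheory

open Filter Topology Set

open scoped NNReal

lemma hasDerivAt_gaussianPDFReal (μ : ℝ) {v : ℝ≥0} (hv : v ≠ 0) (x : ℝ) :
    HasDerivAt (gaussianPDFReal μ v) (-((x - μ) / v * gaussianPDFReal μ v x)) x := by
  have hv' : (v : ℝ) ≠ 0 := by exact_mod_cast hv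
  have h : HasDerivAt (fun y : ℝ ↦ -(y - μ) ^ 2 / (2 * v)) (-((x - μ) / v)) x := by
    refine ((((hasDerivAt_id' x).sub_const μ).fun_pow 2).fun_neg.div_const
      (2 * (v : ℝ))).congr_deriv ?_
    field_simp
    norm_num [mul_comm]
  rw [gaussianPDFReal_def]
  exact (h.exp.const_mul (√(2 * π * v))⁻¹).congr_deriv (by ring)

lemma tendsto_gaussianPDFReal_atTop (μ : ℝ) {v : ℝ≥0} (hv : v ≠ 0) :
    Tendsto (gaussianPDFReal μ v) atTop (𝓝 0) := by
  have hv' : (0 : ℝ) < 2 * v := by positivity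
  have h : Tendsto (fun x : ℝ ↦ -(x - μ) ^ 2 / (2 * v)) atTop atBot := by
    simp only [neg_div]
    refine tendsto_neg_atTop_atBot.comp (Tendsto.atTop_div_const hv' ?_)
    exact (tendsto_pow_atTop two_ne_zero).comp (tendsto_atTop_add_const_right _ (-μ) tendsto_id)
  simpa [gaussianPDFReal_def] using (tendsto_exp_atBot.comp h).const_mul (√(2 * π * v))⁻¹

/-- Mills' inequality for the upper tail of a Gaussian measure. -/
lemma gaussianReal_real_Ici_le (μ : ℝ) {v : ℝ≥0} (hv : v ≠ 0) {a : ℝ} (ha : 0 < a) :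
    (gaussianReal μ v).real (Ici (μ + a)) ≤ v / a * gaussianPDFReal μ v (μ + a) := by
  have hv' : (v : ℝ) ≠ 0 := by exact_mod_cast hv
  have hderiv (x : ℝ) : HasDerivAt (fun y ↦ -(v / a * gaussianPDFReal μ v y))
      ((x - μ) / a * gaussianPDFReal μ v x) x := by
    refine ((hasDerivAt_gaussianPDFReal μ hv x).const_mul (v / a : ℝ)).fun_neg.congr_deriv ?_
    field_simp
  have hlim : Tendsto (fun y ↦ -(v / a * gaussianPDFReal μ v y)) atTop (𝓝 0) := by
    simpa using ((tendsto_gaussianPDFReal_atTop μ hv).const_mul (v / a : ℝ)).neg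
  have hnonneg : ∀ x ∈ Ioi (μ + a), 0 ≤ (x - μ) / a * gaussianPDFReal μ v x := fun x hx ↦
    mul_nonneg (div_nonneg (by linarith [mem_Ioi.mp hx]) ha.le) (gaussianPDFReal_nonneg μ v x)
  have hint := integrableOn_Ioi_deriv_of_nonneg' (fun x _ ↦ hderiv x) hnonneg hlim
  have heq := integral_Ioi_of_hasDerivAt_of_nonneg' (fun x _ ↦ hderiv x) hnonneg hlim
  rw [zero_sub, neg_neg] at heq
  rw [← heq, measureReal_def, gaussianReal_apply_eq_integral μ hv, integral_Ici_eq_integral_Ioi,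
    ENNReal.toReal_ofReal (integral_nonneg fun x ↦ gaussianPDFReal_nonneg μ v x)]
  refine setIntegral_mono_on (integrable_gaussianPDFReal μ v).integrableOn hint
    measurableSet_Ioi fun x hx ↦ ?_
  refine le_mul_of_one_le_left (gaussianPDFReal_nonneg μ v x) ?_
  rw [one_le_div ha]
  linarith [mem_Ioi.mp hx]

/-- Mills' inequality for the lower tail of a Gaussian measure. -/
lemma gaussianReal_real_Iic_le (μ : ℝ) {v : ℝ≥0} (hv : v ≠ 0) {a : ℝ} (ha : 0 < a) :
    (gaussianReal μ v).real (Iic (μ - a)) ≤ v / a * gaussianPDFReal μ v (μ + a) := by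
  have hmap : (gaussianReal μ v).real (Iic (μ - a)) =
      (gaussianReal (-μ) v).real (Ici (-μ + a)) := by
    rw [← gaussianReal_map_neg, map_measureReal_apply measurable_neg measurableSet_Ici]
    congr 1
    ext x
    simp only [mem_Iic, mem_preimage, mem_Ici]
    constructor <;> intro h <;> linarith
  rw [hmap]
  simpa [gaussianPDFReal] using gaussianReal_real_Ici_le (-μ) hv ha

lemma mills_bound_lt {n : ℕ} (hn : 63 ≤ n) (μ : ℝ) :
    (((n : ℝ≥0)⁻¹ : ℝ≥0) : ℝ) / 0.429 * gaussianPDFReal μ (n : ℝ≥0)⁻¹ (μ + 0.429) < 1 / 2000 := by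
  have hn' : (63 : ℝ) ≤ n := by exact_mod_cast hn
  have hn0 : (0 : ℝ) < n := by linarith
  have hsqrt : n * √(2 * π * (n : ℝ)⁻¹) = √(2 * π * n) := by
    rw [eq_comm, sqrt_eq_iff_mul_self_eq_of_pos (by positivity), mul_mul_mul_comm,
      mul_self_sqrt (by positivity)]
    field_simp
  have hsqrt_le : 19.8 ≤ √(2 * π * n) := by
    apply le_sqrt_of_sq_le
    nlinarith [pi_gt_d2]
  have hexp : 235.5 < exp (n * 0.429 ^ 2 / 2) := by
    have h5 : (2.7182818283 : ℝ) ^ 5 < exp 5 := by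
      rw [← mul_one (5 : ℝ), show (5 : ℝ) * 1 = (5 : ℕ) * 1 by norm_num, exp_nat_mul]
      exact pow_lt_pow_left₀ exp_one_gt_d9 (by norm_num) (by norm_num)
    have hrest := add_one_le_exp (0.797 : ℝ)
    calc (235.5 : ℝ) < 2.7182818283 ^ 5 * (0.797 + 1) := by norm_num
      _ ≤ exp 5 * exp 0.797 := by gcongr
      _ = exp (5 + 0.797) := (exp_add _ _).symm
      _ ≤ exp (n * 0.429 ^ 2 / 2) := by
        gcongr
        linarith
  have hrw : (((n : ℝ≥0)⁻¹ : ℝ≥0) : ℝ) / 0.429 * gaussianPDFReal μ (n : ℝ≥0)⁻¹ (μ + 0.429) =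
      (0.429 * √(2 * π * n) * exp (n * 0.429 ^ 2 / 2))⁻¹ := by
    rw [gaussianPDFReal, ← hsqrt, NNReal.coe_inv, NNReal.coe_natCast, add_sub_cancel_left,
      show -(0.429 : ℝ) ^ 2 / (2 * (n : ℝ)⁻¹) = -(n * 0.429 ^ 2 / 2) by field_simp, exp_neg]
    simp only [mul_inv, div_eq_mul_inv]
    ring
  rw [hrw, one_div]
  refine inv_strictAnti₀ (by norm_num) ?_
  calc (2000 : ℝ) < 0.429 * 19.8 * 235.5 := by norm_num
    _ ≤ 0.429 * √(2 * π * n) * exp (n * 0.429 ^ 2 / 2) := by gcongr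

/-- For every integer `n ≥ 63`, the Gaussian probability measure on `ℝ`
with mean `π/2` and variance `1/n` assigns mass greater than `0.999` to the IEEE 754
exponent-127 interval `[1, 2)`. -/
theorem gaussian_angle_concentration (n : ℕ) (hn : 63 ≤ n) :
    (999 / 1000 : ENNReal) < gaussianReal (π / 2) ((n : NNReal))⁻¹ (Set.Ico 1 2) := by
  have hv : (n : ℝ≥0)⁻¹ ≠ 0 := inv_ne_zero (by exact_mod_cast (by omega : n ≠ 0))
  have ha : (0 : ℝ) < 0.429 := by norm_num
  have hsub : (Ico (1 : ℝ) 2)ᶜ ⊆ Iic (π / 2 - 0.429) ∪ Ici (π / 2 + 0.429) := by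
    intro x hx
    by_contra h
    simp only [mem_union, mem_Iic, mem_Ici, not_or, not_le] at h
    exact hx ⟨by linarith [pi_gt_d4], by linarith [pi_lt_d4]⟩
  have hcompl : (gaussianReal (π / 2) (n : ℝ≥0)⁻¹).real (Ico 1 2)ᶜ < 1 / 1000 := by
    linarith [measureReal_mono (μ := gaussianReal (π / 2) (n : ℝ≥0)⁻¹) hsub,
      measureReal_union_le (μ := gaussianReal (π / 2) (n : ℝ≥0)⁻¹)
        (Iic (π / 2 - 0.429)) (Ici (π / 2 + 0.429)),
      gaussianReal_real_Iic_le (π / 2) hv ha, gaussianReal_real_Ici_le (π / 2) hv ha,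
      mills_bound_lt hn (π / 2)]
  rw [probReal_compl_eq_one_sub measurableSet_Ico] at hcompl
  rw [← ENNReal.toReal_lt_toReal (by finiteness) (by finiteness), ← measureReal_def]
  norm_num
  linarith
end

section
/- Let n be an integer with n ≥ 63, and let μ_n be the probability measure on [0, π] with density θ ↦ sinⁿ θ / ∫₀^π sinⁿ t dt with respect to Lebesgue measure. Then μ_n([1, 2)) > 0.999. -/
open Real MeasureTheory

/-- The probability measure on `[0, π]` with density
`θ ↦ sinⁿ θ / ∫₀^π sinⁿ t dt` with respect to Lebesgue measure: the exact marginal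
distribution of a polar angle of a uniform random point on a high-dimensional sphere. -/
noncomputable def angleDist (n : ℕ) : Measure ℝ :=
  (volume.restrict (Set.Icc 0 π)).withDensity
    (fun θ => ENNReal.ofReal (Real.sin θ ^ n / ∫ t in (0:ℝ)..π, Real.sin t ^ n))

theorem integral_sin_pow_le_div_cos (n : ℕ) {a : ℝ} (ha0 : 0 ≤ a) (ha : a < π / 2) :
    ∫ x in (0 : ℝ)..a, sin x ^ n ≤ sin a ^ (n + 1) / ((n + 1) * cos a) := by
  have hc : 0 < cos a := cos_pos_of_mem_Ioo ⟨by linarith [pi_pos], ha⟩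
  have hprim : ∫ x in (0 : ℝ)..a, sin x ^ n * cos x = sin a ^ (n + 1) / (n + 1) := by
    simpa [integral_pow] using integral_sin_pow_mul_cos_pow_odd (a := 0) (b := a) n 0
  have hmono : ∫ x in (0 : ℝ)..a, sin x ^ n * cos a ≤ ∫ x in (0 : ℝ)..a, sin x ^ n * cos x := by
    refine intervalIntegral.integral_mono_on ha0
      (Continuous.intervalIntegrable (by fun_prop) _ _)
      (Continuous.intervalIntegrable (by fun_prop) _ _) fun x hx => ?_
    have hx_pi : x ≤ π := by linarith [hx.2, pi_pos]
    exact mul_le_mul_of_nonneg_left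
      (cos_le_cos_of_nonneg_of_le_pi hx.1 (by linarith [pi_pos]) hx.2)
      (pow_nonneg (sin_nonneg_of_nonneg_of_le_pi hx.1 hx_pi) n)
  rw [intervalIntegral.integral_mul_const, hprim] at hmono
  rw [← div_div]
  exact (le_div_iff₀ hc).2 hmono

theorem sin_two_pow_mul_integral_le (n k : ℕ) :
    sin 2 ^ k * ∫ x in (π - 2)..2, sin x ^ n ≤ ∫ x in (π - 2)..2, sin x ^ (n + k) := by
  rw [← intervalIntegral.integral_const_mul]
  refine intervalIntegral.integral_mono_on (by linarith [pi_lt_four])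
    (Continuous.intervalIntegrable (by fun_prop) _ _)
    (Continuous.intervalIntegrable (by fun_prop) _ _) fun x hx => ?_
  have hs2 : 0 ≤ sin 2 := sin_nonneg_of_nonneg_of_le_pi zero_le_two two_le_pi
  have hsin : sin 2 ≤ sin x := by
    rw [← cos_sub_pi_div_two 2, ← cos_sub_pi_div_two x, ← cos_abs (x - π / 2)]
    refine cos_le_cos_of_nonneg_of_le_pi (abs_nonneg _) (by linarith [pi_pos, two_le_pi])
      (abs_le.2 ⟨by linarith [hx.1], by linarith [hx.2]⟩)
  rw [pow_add, mul_comm]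
  exact mul_le_mul_of_nonneg_left (pow_le_pow_left₀ hs2 hsin k) (pow_nonneg (hs2.trans hsin) n)

theorem neg_cos_two_gt : 0.409 < -cos 2 := by
  have h1 : sin 0.4292 < sin (2 - π / 2) :=
    sin_lt_sin_of_lt_of_le_pi_div_two (by linarith [pi_pos]) (by linarith [two_le_pi])
      (by linarith [pi_lt_d4])
  rw [sin_sub_pi_div_two] at h1
  have h2 := sin_gt_sub_cube (x := 0.4292) (by norm_num)
  linarith

theorem sin_two_pow_le : sin 2 ^ 64 ≤ 0.00287 := by
  have h : sin 2 ^ 2 ≤ 0.8328 := by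
    nlinarith [sin_sq_add_cos_sq 2, neg_cos_two_gt]
  calc sin 2 ^ 64 = (sin 2 ^ 2) ^ 32 := by ring
    _ ≤ 0.8328 ^ 32 := by gcongr
    _ ≤ 0.00287 := by norm_num

theorem integral_sin_pow_sixty_three_ge : 0.31 ≤ ∫ x in (0 : ℝ)..π, sin x ^ 63 := by
  rw [show 63 = 2 * 31 + 1 by norm_num, integral_sin_pow_odd]
  norm_num [Finset.prod_range_succ]

theorem integral_sin_pow_two_pi (n : ℕ) :
    ∫ x in (2 : ℝ)..π, sin x ^ n = ∫ x in (0 : ℝ)..(π - 2), sin x ^ n := by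
  simpa using (intervalIntegral.integral_comp_sub_left (a := 2) (b := π) (fun x => sin x ^ n) π)

theorem integral_sin_pow_zero_pi_eq (n : ℕ) :
    ∫ x in (0 : ℝ)..π, sin x ^ n =
      2 * (∫ x in (0 : ℝ)..(π - 2), sin x ^ n) + ∫ x in (π - 2)..2, sin x ^ n := by
  have hint (a b : ℝ) : IntervalIntegrable (fun x => sin x ^ n) volume a b :=
    Continuous.intervalIntegrable (by fun_prop) _ _
  rw [← intervalIntegral.integral_add_adjacent_intervals (hint 0 2) (hint 2 π),
    ← intervalIntegral.integral_add_adjacent_intervals (hint 0 (π - 2)) (hint (π - 2) 2),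
    integral_sin_pow_two_pi]
  ring

theorem integral_sin_pow_zero_pi_sub_two_le (k : ℕ) :
    ∫ x in (0 : ℝ)..(π - 2), sin x ^ (63 + k) ≤ sin 2 ^ k * 0.00011 := by
  have hs : 0 < sin 2 := sin_pos_of_pos_of_lt_pi two_pos (by linarith [pi_gt_three])
  have hc := neg_cos_two_gt
  refine (integral_sin_pow_le_div_cos _ (by linarith [two_le_pi])
    (by linarith [pi_lt_four])).trans ?_
  rw [sin_pi_sub, cos_pi_sub, show 63 + k + 1 = k + 64 by ring, pow_add, mul_div_assoc]
  refine mul_le_mul_of_nonneg_left ?_ (by positivity)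
  calc sin 2 ^ 64 / (((63 + k : ℕ) + 1) * -cos 2) ≤ 0.00287 / ((63 + 1) * 0.409) := by
        gcongr
        · exact sin_two_pow_le
        · push_cast
          linarith [k.cast_nonneg (α := ℝ)]
    _ ≤ 0.00011 := by norm_num

theorem integral_sin_pow_one_two_gt {n : ℕ} (hn : 63 ≤ n) :
    0.999 * ∫ x in (0 : ℝ)..π, sin x ^ n < ∫ x in (1 : ℝ)..2, sin x ^ n := by
  obtain ⟨k, rfl⟩ := Nat.exists_eq_add_of_le hn
  have hs : 0 < sin 2 ^ k :=
    pow_pos (sin_pos_of_pos_of_lt_pi two_pos (by linarith [pi_gt_three])) k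
  have htail := integral_sin_pow_zero_pi_sub_two_le k
  have htail0 := integral_sin_pow_zero_pi_sub_two_le 0
  have htotal := integral_sin_pow_sixty_three_ge
  rw [integral_sin_pow_zero_pi_eq] at htotal ⊢
  have hmid : sin 2 ^ k * 0.309 ≤ ∫ x in (π - 2)..2, sin x ^ (63 + k) := by
    refine le_trans ?_ (sin_two_pow_mul_integral_le 63 k)
    gcongr
    norm_num at htail0 htotal ⊢
    linarith
  have hsub : ∫ x in (π - 2)..2, sin x ^ (63 + k) ≤ ∫ x in (1 : ℝ)..2, sin x ^ (63 + k) := by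
    have hint (a b : ℝ) : IntervalIntegrable (fun x => sin x ^ (63 + k)) volume a b :=
      Continuous.intervalIntegrable (by fun_prop) _ _
    rw [← intervalIntegral.integral_add_adjacent_intervals (hint 1 (π - 2)) (hint (π - 2) 2)]
    refine le_add_of_nonneg_left (intervalIntegral.integral_nonneg (by linarith [pi_gt_three])
      fun x hx => pow_nonneg (sin_nonneg_of_nonneg_of_le_pi ?_ ?_) _)
    · linarith [hx.1]
    · linarith [hx.2]
  norm_num at *
  linarith

theorem angleDist_Ico {a b : ℝ} (n : ℕ) (ha : 0 ≤ a) (hab : a ≤ b) (hb : b ≤ π) :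
    angleDist n (Set.Ico a b) =
      ENNReal.ofReal ((∫ x in a..b, sin x ^ n) / ∫ x in (0 : ℝ)..π, sin x ^ n) := by
  have hsub : Set.Ico a b ⊆ Set.Icc 0 π := fun x hx => ⟨ha.trans hx.1, hx.2.le.trans hb⟩
  rw [angleDist, withDensity_apply _ measurableSet_Ico,
    Measure.restrict_restrict measurableSet_Ico, Set.inter_eq_left.2 hsub,
    ← intervalIntegral.integral_div, intervalIntegral.integral_of_le hab,
    ← integral_Ico_eq_integral_Ioc, ofReal_integral_eq_lintegral_ofReal]
  · exact (Continuous.integrableOn_Icc (by fun_prop)).mono_set Set.Ico_subset_Icc_self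
  · refine (ae_restrict_iff' measurableSet_Ico).2 (.of_forall fun x hx => ?_)
    exact div_nonneg (pow_nonneg (sin_nonneg_of_mem_Icc (hsub hx)) n) (integral_sin_pow_pos n).le

/-- For every integer `n ≥ 63`, the measure with density proportional to
`sinⁿ θ` on `[0, π]` assigns mass greater than `0.999` to `[1, 2)`. -/
theorem angleDist_concentration (n : ℕ) (hn : 63 ≤ n) :
    (999 / 1000 : ENNReal) < angleDist n (Set.Ico 1 2) := by
  have hmass : (999 / 1000 : ENNReal) = ENNReal.ofReal 0.999 := by
    rw [show (0.999 : ℝ) = 999 / 1000 by norm_num, ENNReal.ofReal_div_of_pos (by norm_num)]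
    norm_num
  rw [angleDist_Ico n zero_le_one one_le_two two_le_pi, hmass]
  have h := (lt_div_iff₀ (integral_sin_pow_pos n)).2 (integral_sin_pow_one_two_gt hn)
  exact (ENNReal.ofReal_lt_ofReal_iff ((by norm_num : (0 : ℝ) < 0.999).trans h)).2 h
end

section
/- Let n be an integer with n ≥ 1, and let μ_n be the probability measure on [0, π] with density θ ↦ sinⁿ θ / ∫₀^π sinⁿ t dt with respect to Lebesgue measure. Then for every t ≥ 0, μ_n({θ ∈ [0, π] : |θ − π/2| ≥ t}) ≤ 2 · exp(−n t² / 2). -/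
open Real MeasureTheory

theorem angleDist_univ (n : ℕ) : angleDist n Set.univ = 1 := by
  have hZ : 0 < ∫ t in (0:ℝ)..π, Real.sin t ^ n := integral_sin_pow_pos n
  rw [angleDist, withDensity_apply _ MeasurableSet.univ, Measure.restrict_univ,
    ← ofReal_integral_eq_lintegral_ofReal, integral_div, integral_Icc_eq_integral_Ioc,
    ← intervalIntegral.integral_of_le Real.pi_pos.le, div_self hZ.ne', ENNReal.ofReal_one]
  · exact ContinuousOn.integrableOn_Icc (by fun_prop)
  · filter_upwards [ae_restrict_mem measurableSet_Icc] with θ hθ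
    exact div_nonneg (pow_nonneg (Real.sin_nonneg_of_mem_Icc hθ) n) hZ.le

/-- If translation by `c` maps `A` into `[0, π]` and increases the sine by a factor at least `1 / r`,
then `A` has mass at most `r ^ n`. -/
theorem angleDist_le_pow_of_sin_le_mul_sin_add (n : ℕ) {A : Set ℝ} (hA : MeasurableSet A)
    {c r : ℝ} (hr : 0 ≤ r) (hsub : A ⊆ Set.Icc 0 π) (hshift : ∀ θ ∈ A, θ + c ∈ Set.Icc 0 π)
    (hsin : ∀ θ ∈ A, Real.sin θ ≤ r * Real.sin (θ + c)) :
    angleDist n A ≤ ENNReal.ofReal (r ^ n) := by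
  have hZ : 0 < ∫ t in (0:ℝ)..π, Real.sin t ^ n := integral_sin_pow_pos n
  set f : ℝ → ENNReal :=
    fun θ => ENNReal.ofReal (Real.sin θ ^ n / ∫ t in (0:ℝ)..π, Real.sin t ^ n) with hf
  have hmass : ∫⁻ θ, (Set.Icc 0 π).indicator f θ = 1 := by
    rw [lintegral_indicator measurableSet_Icc, ← angleDist_univ n, angleDist,
      withDensity_apply _ MeasurableSet.univ, Measure.restrict_univ]
  calc angleDist n A = ∫⁻ θ in A, f θ := by
        rw [angleDist, withDensity_apply _ hA, Measure.restrict_restrict hA,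
          Set.inter_eq_left.mpr hsub]
    _ ≤ ∫⁻ θ in A, ENNReal.ofReal (r ^ n) * (Set.Icc 0 π).indicator f (θ + c) := by
        refine setLIntegral_mono' hA fun θ hθ => ?_
        rw [Set.indicator_of_mem (hshift θ hθ), hf, ← ENNReal.ofReal_mul (pow_nonneg hr n),
          ← mul_div_assoc, ← mul_pow]
        have h0 := Real.sin_nonneg_of_mem_Icc (hsub hθ)
        have h1 := hsin θ hθ
        dsimp only
        gcongr
    _ ≤ ∫⁻ θ, ENNReal.ofReal (r ^ n) * (Set.Icc 0 π).indicator f (θ + c) :=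
        setLIntegral_le_lintegral _ _
    _ = ENNReal.ofReal (r ^ n) := by
        rw [lintegral_const_mul' _ _ ENNReal.ofReal_ne_top,
          lintegral_add_right_eq_self ((Set.Icc 0 π).indicator f), hmass, mul_one]

theorem cos_le_exp_neg_half_sq {x : ℝ} (hx0 : 0 ≤ x) (hx : x ≤ π / 2) :
    Real.cos x ≤ Real.exp (-x ^ 2 / 2) := by
  have hderiv (y : ℝ) : HasDerivAt (fun y => Real.cos y * Real.exp (y ^ 2 / 2))
      ((y * Real.cos y - Real.sin y) * Real.exp (y ^ 2 / 2)) y := by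
    have h := (Real.hasDerivAt_cos y).mul (((hasDerivAt_pow 2 y).div_const 2).exp)
    refine h.congr_deriv ?_
    norm_num
    ring
  have hanti : AntitoneOn (fun y => Real.cos y * Real.exp (y ^ 2 / 2)) (Set.Icc 0 (π / 2)) := by
    refine antitoneOn_of_deriv_nonpos (convex_Icc _ _) (by fun_prop)
      (fun y _ => (hderiv y).differentiableAt.differentiableWithinAt) fun y hy => ?_
    rw [interior_Icc] at hy
    rw [(hderiv y).deriv]
    have hcos : 0 < Real.cos y := Real.cos_pos_of_mem_Ioo ⟨by linarith [hy.1, Real.pi_pos], hy.2⟩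
    have htan := Real.le_tan hy.1.le hy.2
    rw [Real.tan_eq_sin_div_cos, le_div_iff₀ hcos] at htan
    exact mul_nonpos_of_nonpos_of_nonneg (by linarith) (Real.exp_nonneg _)
  have h := hanti ⟨le_rfl, by positivity⟩ ⟨hx0, hx⟩ hx0
  have h1 : Real.cos x * Real.exp (x ^ 2 / 2) ≤ 1 := by simpa using h
  rw [neg_div, Real.exp_neg, ← one_div]
  exact (le_div_iff₀ (Real.exp_pos _)).mpr h1

theorem cos_add_le_exp_mul_cos {s t : ℝ} (hs : 0 ≤ s) (ht : 0 ≤ t) (hst : s + t ≤ π / 2) :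
    Real.cos (s + t) ≤ Real.exp (-t ^ 2 / 2) * Real.cos s := by
  have hpi := Real.pi_pos
  have hcos : 0 ≤ Real.cos s := Real.cos_nonneg_of_mem_Icc ⟨by linarith, by linarith⟩
  have hsin : 0 ≤ Real.sin s * Real.sin t :=
    mul_nonneg (Real.sin_nonneg_of_nonneg_of_le_pi hs (by linarith))
      (Real.sin_nonneg_of_nonneg_of_le_pi ht (by linarith))
  have hexp := mul_le_mul_of_nonneg_right
    (cos_le_exp_neg_half_sq ht (by linarith : t ≤ π / 2)) hcos
  rw [Real.cos_add]
  linarith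

/-- For every integer `n ≥ 1` and every `t ≥ 0`, the measure with density
proportional to `sinⁿ θ` on `[0, π]` satisfies the sub-Gaussian tail bound
`μ_n({θ ∈ [0, π] : |θ − π/2| ≥ t}) ≤ 2·exp(−n t²/2)`. -/
theorem angleDist_subgaussian_tail (n : ℕ) (hn : 1 ≤ n) (t : ℝ) (ht : 0 ≤ t) :
    angleDist n {θ | θ ∈ Set.Icc 0 π ∧ t ≤ |θ - π / 2|}
      ≤ ENNReal.ofReal (2 * Real.exp (-(n : ℝ) * t ^ 2 / 2)) := by
  have hpi := Real.pi_pos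
  have hpow : Real.exp (-(n : ℝ) * t ^ 2 / 2) = Real.exp (-t ^ 2 / 2) ^ n := by
    rw [← Real.exp_nat_mul]
    ring_nf
  have hupper : angleDist n (Set.Icc (π / 2 + t) π) ≤
      ENNReal.ofReal (Real.exp (-t ^ 2 / 2) ^ n) := by
    refine angleDist_le_pow_of_sin_le_mul_sin_add n measurableSet_Icc (c := -t) (Real.exp_nonneg _)
      (Set.Icc_subset_Icc_left (by linarith))
      (fun θ hθ => ⟨by linarith [hθ.1], by linarith [hθ.2]⟩) fun θ hθ => ?_
    have h := cos_add_le_exp_mul_cos (s := θ - π / 2 - t) (by linarith [hθ.1]) ht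
      (by linarith [hθ.2])
    rwa [sub_add_cancel, Real.cos_sub_pi_div_two, sub_right_comm, Real.cos_sub_pi_div_two,
      sub_eq_add_neg] at h
  have hlower : angleDist n (Set.Icc 0 (π / 2 - t)) ≤
      ENNReal.ofReal (Real.exp (-t ^ 2 / 2) ^ n) := by
    refine angleDist_le_pow_of_sin_le_mul_sin_add n measurableSet_Icc (c := t) (Real.exp_nonneg _)
      (Set.Icc_subset_Icc_right (by linarith))
      (fun θ hθ => ⟨by linarith [hθ.1], by linarith [hθ.2]⟩) fun θ hθ => ?_
    have h := cos_add_le_exp_mul_cos (s := π / 2 - (θ + t)) (by linarith [hθ.2]) ht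
      (by linarith [hθ.1])
    rwa [show π / 2 - (θ + t) + t = π / 2 - θ by ring, Real.cos_pi_div_two_sub,
      Real.cos_pi_div_two_sub] at h
  have hcover : {θ | θ ∈ Set.Icc 0 π ∧ t ≤ |θ - π / 2|} ⊆
      Set.Icc (π / 2 + t) π ∪ Set.Icc 0 (π / 2 - t) := by
    rintro θ ⟨hθ, h⟩
    rcases le_abs.mp h with h | h
    · exact Or.inl ⟨by linarith, hθ.2⟩
    · exact Or.inr ⟨hθ.1, by linarith⟩
  rw [hpow, two_mul, ENNReal.ofReal_add (by positivity) (by positivity)]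
  exact (measure_mono hcover).trans ((measure_union_le _ _).trans (add_le_add hupper hlower))
end
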